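/- Let φ be a formula of the basic modal language L (no refinement quantifiers), a ∈ A, and p ∈ P a variable not occurring in φ. Then for every pointed model M_s: (1) M_s ⊨ ∃_a φ (in refinement modal logic) if and only if M_s ⊨ ∃̃p φ^{(a,p)} (in bisimulation quantified modal logic); (2) M_s ⊨ ∃ φ if and only if M_s ⊨ ∃̃p φ^p, where ∃ = ∃_A and φ^p is the relativization of φ to p performed successively for all agents of A. -/

import Mathlib

/-- A Kripke model over agents `A` and propositional variables `P`. -/
structure KModel (A P : Type) where
  S : Type
  R : A → S → S → Prop
  V : P → S → Prop

/-- `Refines B M s N t`: there is a `B`-refinement from `M_s` to `N_t`. -/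
def Refines {A P : Type} (B : Set A) (M : KModel A P) (s : M.S)
    (N : KModel A P) (t : N.S) : Prop :=
  ∃ Z : M.S → N.S → Prop,
    Z s t ∧
    (∀ u v, Z u v → ∀ p, M.V p u ↔ N.V p v) ∧
    (∀ a : A, ∀ u v, Z u v → ∀ v', N.R a v v' → ∃ u', M.R a u u' ∧ Z u' v') ∧
    (∀ a : A, a ∉ B → ∀ u v, Z u v → ∀ u', M.R a u u' → ∃ v', N.R a v v' ∧ Z u' v')

/-- `RBisimP p M s N t`: there is a `p`-restricted bisimulation between `M` and `N`
linking `s` and `t` (atoms required only for variables other than `p`). -/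
def RBisimP {A P : Type} (p : P) (M : KModel A P) (s : M.S)
    (N : KModel A P) (t : N.S) : Prop :=
  ∃ Z : M.S → N.S → Prop,
    Z s t ∧
    (∀ u v, Z u v → ∀ q, q ≠ p → (M.V q u ↔ N.V q v)) ∧
    (∀ a : A, ∀ u v, Z u v → ∀ u', M.R a u u' → ∃ v', N.R a v v' ∧ Z u' v') ∧
    (∀ a : A, ∀ u v, Z u v → ∀ v', N.R a v v' → ∃ u', M.R a u u' ∧ Z u' v')

/-- The basic multi-agent modal language `L`. -/
inductive Form (A P : Type) : Type where
  | atom : P → Form A P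
  | neg : Form A P → Form A P
  | and : Form A P → Form A P → Form A P
  | box : A → Form A P → Form A P

/-- Standard Kripke satisfaction for the basic modal language. -/
def FSat {A P : Type} (M : KModel A P) : M.S → Form A P → Prop
  | s, .atom p => M.V p s
  | s, .neg φ => ¬ FSat M s φ
  | s, .and φ ψ => FSat M s φ ∧ FSat M s ψ
  | s, .box a φ => ∀ t, M.R a s t → FSat M t φ

/-- Material implication. -/
def fimpF {A P : Type} (φ ψ : Form A P) : Form A P := .neg (.and φ (.neg ψ))

/-- Relativization `φ^{(a,p)}` to `p` for agent `a` (on the basic language). -/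
def relA {A P : Type} [DecidableEq A] (a : A) (p : P) : Form A P → Form A P
  | .atom q => .atom q
  | .neg φ => .neg (relA a p φ)
  | .and φ ψ => .and (relA a p φ) (relA a p ψ)
  | .box b φ =>
      if b = a then .box b (fimpF (.atom p) (relA a p φ)) else .box b (relA a p φ)

/-- The variable `p` occurs in the formula. -/
def occursF {A P : Type} (p : P) : Form A P → Prop
  | .atom q => q = p
  | .neg φ => occursF p φ
  | .and φ ψ => occursF p φ ∨ occursF p ψ
  | .box _ φ => occursF p φ

/-- `ExList l M s φ`: the stack `∃_{a₁} … ∃_{aₙ} φ` (for `l = [a₁, …, aₙ]`)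
holds at `M_s`. -/
def ExList {A P : Type} : List A → (M : KModel A P) → M.S → Form A P → Prop
  | [], M, s, φ => FSat M s φ
  | a :: l, M, s, φ =>
      ∃ (N : KModel A P) (t : N.S), Refines {a} M s N t ∧ ExList l N t φ

/-- `φ^p`: relativization to `p` performed successively for all agents in `l`. -/
def relList {A P : Type} [DecidableEq A] (l : List A) (p : P) (φ : Form A P) :
    Form A P :=
  l.foldr (fun a ψ => relA a p ψ) φ

/-- The model `N` in which the arrows of agents in `B` only lead to states where `p` holds. -/
def KModel.restrictTo {A P : Type} (N : KModel A P) (B : Set A) (p : P) : KModel A P where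
  S := N.S
  R b u v := N.R b u v ∧ (b ∈ B → N.V p v)
  V := N.V

/-- The model `N` in which the valuation of `p` is replaced by `X`. -/
def KModel.setVal {A P : Type} (N : KModel A P) (p : P) (X : N.S → Prop) : KModel A P where
  S := N.S
  R := N.R
  V q u := (q = p ∧ X u) ∨ (q ≠ p ∧ N.V q u)

/-- The synchronized product of `M` and `N` along `Z`, with the valuation of `M`, together with a
copy of `M` that agents in `C` can reach from the product. -/
def KModel.mix {A P : Type} (M N : KModel A P) (Z : M.S → N.S → Prop) (C : Set A) :
    KModel A P where
  S := M.S ⊕ {x : M.S × N.S // Z x.1 x.2}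
  R b
    | .inl u, .inl u' => M.R b u u'
    | .inl _, .inr _ => False
    | .inr x, .inl u' => b ∈ C ∧ M.R b x.1.1 u'
    | .inr x, .inr y => M.R b x.1.1 y.1.1 ∧ N.R b x.1.2 y.1.2
  V q
    | .inl u => M.V q u
    | .inr x => M.V q x.1.1

/-- The synchronized product of `N` and `M` along `Z`, with the valuation of `M`. -/
def KModel.prodAlong {A P : Type} (N M : KModel A P) (Z : N.S → M.S → Prop) : KModel A P where
  S := {x : N.S × M.S // Z x.1 x.2}
  R b x y := N.R b x.1.1 y.1.1 ∧ M.R b x.1.2 y.1.2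
  V q x := M.V q x.1.2

/-- Formulas without `p` are invariant under `p`-restricted bisimulation. -/
theorem RBisimP.fsat_iff {A P : Type} {p : P} {M N : KModel A P} {s : M.S} {t : N.S}
    (h : RBisimP p M s N t) {φ : Form A P} (hφ : ¬ occursF p φ) :
    FSat M s φ ↔ FSat N t φ := by
  obtain ⟨Z, hst, hat, hforth, hback⟩ := h
  induction φ generalizing s t with
  | atom q => exact hat s t hst q hφ
  | neg φ ih => exact not_congr (ih hφ hst)
  | and φ ψ ih₁ ih₂ =>
    exact and_congr (ih₁ (fun h => hφ (Or.inl h)) hst) (ih₂ (fun h => hφ (Or.inr h)) hst)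
  | box b φ ih =>
    constructor
    · intro H v hv
      obtain ⟨u, hu, huv⟩ := hback b s t hst v hv
      exact (ih hφ huv).1 (H u hu)
    · intro H u hu
      obtain ⟨v, hv, huv⟩ := hforth b s t hst u hu
      exact (ih hφ huv).2 (H v hv)

theorem Refines.refl {A P : Type} (B : Set A) (M : KModel A P) (s : M.S) : Refines B M s M s := by
  refine ⟨Eq, rfl, ?_, ?_, ?_⟩
  · rintro u _ rfl q
    exact Iff.rfl
  · rintro b u _ rfl v' hv'
    exact ⟨v', hv', rfl⟩
  · rintro b - u _ rfl u' hu'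
    exact ⟨u', hu', rfl⟩

theorem Refines.trans {A P : Type} {B C : Set A} {M K N : KModel A P} {s : M.S} {k : K.S} {t : N.S}
    (h₁ : Refines B M s K k) (h₂ : Refines C K k N t) : Refines (B ∪ C) M s N t := by
  obtain ⟨Z, hsk, hat, hback, hforth⟩ := h₁
  obtain ⟨Y, hkt, hat', hback', hforth'⟩ := h₂
  refine ⟨fun u v => ∃ w, Z u w ∧ Y w v, ⟨k, hsk, hkt⟩, ?_, ?_, ?_⟩
  · rintro u v ⟨w, hz, hy⟩ q
    exact (hat u w hz q).trans (hat' w v hy q)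
  · rintro b u v ⟨w, hz, hy⟩ v' hv'
    obtain ⟨w', hw', hy'⟩ := hback' b w v hy v' hv'
    obtain ⟨u', hu', hz'⟩ := hback b u w hz w' hw'
    exact ⟨u', hu', w', hz', hy'⟩
  · rintro b hb u v ⟨w, hz, hy⟩ u' hu'
    obtain ⟨w', hw', hz'⟩ := hforth b (fun h => hb (Or.inl h)) u w hz u' hu'
    obtain ⟨v', hv', hy'⟩ := hforth' b (fun h => hb (Or.inr h)) w v hy w' hw'
    exact ⟨v', hv', w', hz', hy'⟩

/-- A `B ∪ C`-refinement factors as a `B`-refinement followed by a `C`-refinement. -/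
theorem Refines.exists_factor {A P : Type} {B C : Set A} {M N : KModel A P} {s : M.S} {t : N.S}
    (h : Refines (B ∪ C) M s N t) :
    ∃ (K : KModel A P) (k : K.S), Refines B M s K k ∧ Refines C K k N t := by
  obtain ⟨Z, hst, hat, hback, hforth⟩ := h
  refine ⟨M.mix N Z C, .inr ⟨(s, t), hst⟩,
    ⟨fun u x => u = Sum.elim id (fun y => y.1.1) x, rfl, ?_, ?_, ?_⟩,
    ⟨fun x v => ∃ y, x = .inr y ∧ y.1.2 = v, ⟨_, rfl, rfl⟩, ?_, ?_, ?_⟩⟩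
  · rintro _ (u | x) rfl q <;> exact Iff.rfl
  · rintro b _ (u | x) rfl (u' | y) hR
    · exact ⟨u', hR, rfl⟩
    · exact hR.elim
    · exact ⟨u', hR.2, rfl⟩
    · exact ⟨y.1.1, hR.1, rfl⟩
  · rintro b hb _ (u | ⟨⟨_, v⟩, hz⟩) rfl u' hu'
    · exact ⟨.inl u', hu', rfl⟩
    · by_cases hC : b ∈ C
      · exact ⟨.inl u', ⟨hC, hu'⟩, rfl⟩
      · obtain ⟨v', hv', hz'⟩ := hforth b (fun h => h.elim hb hC) _ v hz u' hu'
        exact ⟨.inr ⟨(u', v'), hz'⟩, ⟨hu', hv'⟩, rfl⟩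
  · rintro _ _ ⟨y, rfl, rfl⟩ q
    exact hat _ _ y.2 q
  · rintro b _ _ ⟨y, rfl, rfl⟩ v' hv'
    obtain ⟨u', hu', hz'⟩ := hback b _ _ y.2 v' hv'
    exact ⟨.inr ⟨(u', v'), hz'⟩, ⟨hu', hv'⟩, _, rfl, rfl⟩
  · rintro b hb _ _ ⟨y, rfl, rfl⟩ (u' | y') hR
    · exact (hb hR.1).elim
    · exact ⟨_, hR.2, y', rfl, rfl⟩

/-- A refinement is the restriction to `p` of some `p`-variant, up to `p`-restricted
bisimulation. -/
theorem Refines.exists_rBisimP {A P : Type} {B : Set A} (p : P) {M N : KModel A P} {s : M.S}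
    {t : N.S} (h : Refines B M s N t) :
    ∃ (K : KModel A P) (k : K.S), RBisimP p K k M s ∧ RBisimP p (K.restrictTo B p) k N t := by
  obtain ⟨Z, hst, hat, hback, hforth⟩ := h
  refine ⟨(M.mix N Z B).setVal p (fun x => x.isRight), .inr ⟨(s, t), hst⟩,
    ⟨fun x u => u = Sum.elim id (fun y => y.1.1) x, rfl, ?_, ?_, ?_⟩,
    ⟨fun x v => ∃ y, x = .inr y ∧ y.1.2 = v, ⟨_, rfl, rfl⟩, ?_, ?_, ?_⟩⟩
  · rintro (u | x) _ rfl q hq <;> simp [KModel.setVal, KModel.mix, hq]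
  · rintro b (u | x) _ rfl (u' | y) hR
    · exact ⟨u', hR, rfl⟩
    · exact hR.elim
    · exact ⟨u', hR.2, rfl⟩
    · exact ⟨y.1.1, hR.1, rfl⟩
  · rintro b (u | ⟨⟨_, v⟩, hz⟩) _ rfl u' hu'
    · exact ⟨.inl u', hu', rfl⟩
    · by_cases hB : b ∈ B
      · exact ⟨.inl u', ⟨hB, hu'⟩, rfl⟩
      · obtain ⟨v', hv', hz'⟩ := hforth b hB _ v hz u' hu'
        exact ⟨.inr ⟨(u', v'), hz'⟩, ⟨hu', hv'⟩, rfl⟩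
  · rintro _ _ ⟨y, rfl, rfl⟩ q hq
    simpa [KModel.restrictTo, KModel.setVal, KModel.mix, hq] using hat _ _ y.2 q
  · rintro b _ _ ⟨y, rfl, rfl⟩ (u' | y') ⟨hR, hp⟩
    · obtain ⟨-, hX⟩ | ⟨hne, -⟩ := hp hR.1
      · cases hX
      · exact (hne rfl).elim
    · exact ⟨_, hR.2, y', rfl, rfl⟩
  · rintro b _ _ ⟨y, rfl, rfl⟩ v' hv'
    obtain ⟨u', hu', hz'⟩ := hback b _ _ y.2 v' hv'
    exact ⟨.inr ⟨(u', v'), hz'⟩, ⟨⟨hu', hv'⟩, fun _ => Or.inl ⟨rfl, rfl⟩⟩, _, rfl, rfl⟩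

/-- The restriction to `p` of a `p`-variant is a refinement, up to `p`-restricted bisimulation. -/
theorem RBisimP.exists_refines {A P : Type} (B : Set A) {p : P} {M N : KModel A P} {s : M.S}
    {t : N.S} (h : RBisimP p N t M s) :
    ∃ (K : KModel A P) (k : K.S), Refines B M s K k ∧ RBisimP p (N.restrictTo B p) t K k := by
  obtain ⟨Z, hts, hat, hforth, hback⟩ := h
  refine ⟨(N.restrictTo B p).prodAlong M Z, ⟨(t, s), hts⟩,
    ⟨fun u x => x.1.2 = u, rfl, ?_, ?_, ?_⟩, ⟨fun v x => x.1.1 = v, rfl, ?_, ?_, ?_⟩⟩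
  · rintro _ x rfl q
    exact Iff.rfl
  · rintro b _ x rfl y hR
    exact ⟨_, hR.2, rfl⟩
  · rintro b hb _ x rfl u' hu'
    obtain ⟨v', hv', hz'⟩ := hback b _ _ x.2 u' hu'
    exact ⟨⟨(v', u'), hz'⟩, ⟨⟨hv', fun h => (hb h).elim⟩, hu'⟩, rfl⟩
  · rintro _ x rfl q hq
    exact hat _ _ x.2 q hq
  · rintro b _ x rfl v' hv'
    obtain ⟨u', hu', hz'⟩ := hforth b _ _ x.2 v' hv'.1
    exact ⟨⟨(v', u'), hz'⟩, ⟨hv', hu'⟩, rfl⟩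
  · rintro b _ x rfl y hR
    exact ⟨_, hR.1, rfl⟩

theorem exists_refines_fsat_iff {A P : Type} (B : Set A) {p : P} {φ : Form A P}
    (hφ : ¬ occursF p φ) (M : KModel A P) (s : M.S) :
    (∃ (N : KModel A P) (t : N.S), Refines B M s N t ∧ FSat N t φ) ↔
      ∃ (N : KModel A P) (t : N.S), RBisimP p N t M s ∧ FSat (N.restrictTo B p) t φ := by
  constructor
  · rintro ⟨N, t, h, hsat⟩
    obtain ⟨K, k, hK, hKN⟩ := h.exists_rBisimP p
    exact ⟨K, k, hK, (hKN.fsat_iff hφ).2 hsat⟩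
  · rintro ⟨N, t, h, hsat⟩
    obtain ⟨K, k, hK, hNK⟩ := h.exists_refines B
    exact ⟨K, k, hK, (hNK.fsat_iff hφ).1 hsat⟩

theorem fsat_relA {A P : Type} [DecidableEq A] (a : A) (p : P) (φ : Form A P) (N : KModel A P)
    (t : N.S) : FSat N t (relA a p φ) ↔ FSat (N.restrictTo {a} p) t φ := by
  induction φ generalizing t with
  | atom q => exact Iff.rfl
  | neg φ ih => exact not_congr (ih t)
  | and φ ψ ih₁ ih₂ => exact and_congr (ih₁ t) (ih₂ t)
  | box b φ ih =>
    by_cases hb : b = a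
    · simp only [relA, if_pos hb, fimpF, FSat, ih, not_and, not_not]
      exact ⟨fun H v hv => H v hv.1 (hv.2 hb), fun H v hv hp => H v ⟨hv, fun _ => hp⟩⟩
    · simp only [relA, if_neg hb, FSat, ih]
      exact ⟨fun H v hv => H v hv.1, fun H v hv => H v ⟨hv, fun h => (hb h).elim⟩⟩

theorem fsat_congr_rel {A P S : Type} {R R' : A → S → S → Prop} {V : P → S → Prop}
    (h : ∀ b u v, R b u v ↔ R' b u v) (t : S) (φ : Form A P) :
    FSat ⟨S, R, V⟩ t φ ↔ FSat ⟨S, R', V⟩ t φ := by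
  obtain rfl : R = R' := by
    ext b u v
    exact h b u v
  exact Iff.rfl

theorem fsat_relList {A P : Type} [DecidableEq A] (l : List A) (p : P) (φ : Form A P)
    (N : KModel A P) (t : N.S) :
    FSat N t (relList l p φ) ↔ FSat (N.restrictTo {b | b ∈ l} p) t φ := by
  induction l generalizing N with
  | nil => exact fsat_congr_rel (fun b u v => by simp) t φ
  | cons a l ih =>
    refine (fsat_relA a p (relList l p φ) N t).trans ((ih (N.restrictTo {a} p) t).trans ?_)
    refine fsat_congr_rel (fun b u v => ?_) t φ
    simp [KModel.restrictTo, or_imp, and_assoc]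

theorem exList_iff {A P : Type} {p : P} {φ : Form A P} (hφ : ¬ occursF p φ) (l : List A)
    (M : KModel A P) (s : M.S) :
    ExList l M s φ ↔
      ∃ (N : KModel A P) (t : N.S), Refines {b | b ∈ l} M s N t ∧ FSat N t φ := by
  induction l generalizing M with
  | nil =>
    constructor
    · exact fun h => ⟨M, s, .refl _ M s, h⟩
    · rintro ⟨N, t, ⟨Z, hst, hat, hback, hforth⟩, hsat⟩
      have h : RBisimP p M s N t :=
        ⟨Z, hst, fun u v hz q _ => hat u v hz q, fun b => hforth b List.not_mem_nil, hback⟩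
      exact (h.fsat_iff hφ).2 hsat
  | cons a l ih =>
    have h : ({b | b ∈ a :: l} : Set A) = {a} ∪ {b | b ∈ l} := by
      ext b
      simp
    simp only [ExList, ih, h]
    constructor
    · rintro ⟨K, k, hK, N, t, hN, hsat⟩
      exact ⟨N, t, hK.trans hN, hsat⟩
    · rintro ⟨N, t, hN, hsat⟩
      obtain ⟨K, k, hK, hKN⟩ := hN.exists_factor
      exact ⟨K, k, hK, N, t, hKN, hsat⟩

/-- Refinement quantification is bisimulation quantification plus relativization:
for `∀`-free `φ` and fresh `p`, (1) `∃_a φ` is equivalent to `∃̃p φ^{(a,p)}`, and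
(2) `∃ φ` (the stack of `∃_b` over any enumeration of all agents) is equivalent to
`∃̃p φ^p`. -/
theorem refinement_is_bisimquant_plus_relativization {A P : Type} [DecidableEq A]
    (a : A) (p : P) (φ : Form A P) (hfresh : ¬ occursF p φ)
    (M : KModel A P) (s : M.S) :
    ((∃ (N : KModel A P) (t : N.S), Refines {a} M s N t ∧ FSat N t φ) ↔
      (∃ (N : KModel A P) (t : N.S), RBisimP p N t M s ∧ FSat N t (relA a p φ))) ∧
    (∀ l : List A, l.Nodup → (∀ b : A, b ∈ l) →
      (ExList l M s φ ↔
        ∃ (N : KModel A P) (t : N.S), RBisimP p N t M s ∧ FSat N t (relList l p φ))) := by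
  constructor
  · simp only [fsat_relA]
    exact exists_refines_fsat_iff {a} hfresh M s
  · intro l _ _
    rw [exList_iff hfresh]
    simp only [fsat_relList]
    exact exists_refines_fsat_iff _ hfresh M s
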